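/- Let E be a real normed vector space, L > 0, and let f : E → E satisfy ‖f(u) − f(v)‖ ≤ L‖u − v‖ for all u, v ∈ E. Let m ≥ 1, h > 0, τ = h/m, and for u ∈ E define the Runge–Kutta iterates û₀(u) = u and û_{j+1}(u) = û_j(u) + τ F₄(τ, t, û_j(u); f̃) where f̃(t,x) = f(x). Define the fine integrator F(u) = û_m(u) and the coarse (Euler) integrator C(u) = u + h f(u). Then for all u, v ∈ E: ‖(F(u) − C(u)) − (F(v) − C(v))‖ ≤ ((e^{hM} − 1) + hL) ‖u − v‖ ≤ h(c₆ + L)‖u − v‖ with c₆ = (e^{hM} − 1)/h, where M = L(1 + (1/2)τL + (1/6)τ²L² + (1/24)τ³L³). -/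

import Mathlib

/-- The classical four-stage Runge–Kutta increment function
`F₄(h,t,u;f) = (k₁ + 2k₂ + 2k₃ + k₄)/6`. -/
noncomputable def rkF4 {E : Type*} [NormedAddCommGroup E] [NormedSpace ℝ E]
    (f : ℝ → E → E) (h t : ℝ) (u : E) : E :=
  let k₁ := f t u
  let k₂ := f (t + h / 2) (u + (h / 2) • k₁)
  let k₃ := f (t + h / 2) (u + (h / 2) • k₂)
  let k₄ := f (t + h) (u + h • k₃)
  (1 / 6 : ℝ) • (k₁ + (2 : ℝ) • k₂ + (2 : ℝ) • k₃ + k₄)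

/-- A Lipschitz map evaluated at the explicit stages `x + a • k` and `y + a • l`. -/
lemma norm_stage_sub_le {E : Type*} [NormedAddCommGroup E] [NormedSpace ℝ E] {g : E → E}
    {L a B : ℝ} (hL : 0 ≤ L) (ha : 0 ≤ a) (hg : ∀ x y, ‖g x - g y‖ ≤ L * ‖x - y‖)
    {x y k l : E} (hkl : ‖k - l‖ ≤ B) :
    ‖g (x + a • k) - g (y + a • l)‖ ≤ L * (‖x - y‖ + a * B) := by
  refine (hg _ _).trans (mul_le_mul_of_nonneg_left ?_ hL)
  calc ‖x + a • k - (y + a • l)‖ = ‖(x - y) + a • (k - l)‖ := by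
        congr 1; module
    _ ≤ ‖x - y‖ + ‖a • (k - l)‖ := norm_add_le _ _
    _ ≤ ‖x - y‖ + a * B := by
        rw [norm_smul, Real.norm_of_nonneg ha]
        gcongr

/-- The Runge–Kutta increment of a vector field that is `L`-Lipschitz in space is Lipschitz. -/
lemma norm_rkF4_sub_le {E : Type*} [NormedAddCommGroup E] [NormedSpace ℝ E] {f : ℝ → E → E}
    {L τ : ℝ} (hL : 0 ≤ L) (hτ : 0 ≤ τ) (hf : ∀ s x y, ‖f s x - f s y‖ ≤ L * ‖x - y‖)
    (t : ℝ) (x y : E) :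
    ‖rkF4 f τ t x - rkF4 f τ t y‖ ≤
      L * (1 + (1 / 2) * τ * L + (1 / 6) * τ ^ 2 * L ^ 2 + (1 / 24) * τ ^ 3 * L ^ 3) *
        ‖x - y‖ := by
  have hτ2 : 0 ≤ τ / 2 := by positivity
  have h₁ := hf t x y
  have h₂ := norm_stage_sub_le hL hτ2 (hf (t + τ / 2)) (x := x) (y := y) h₁
  have h₃ := norm_stage_sub_le hL hτ2 (hf (t + τ / 2)) (x := x) (y := y) h₂
  have h₄ := norm_stage_sub_le hL hτ (hf (t + τ)) (x := x) (y := y) h₃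
  simp only [rkF4]
  generalize f t x = k₁ at *
  generalize f t y = l₁ at *
  generalize f (t + τ / 2) (x + (τ / 2) • k₁) = k₂ at *
  generalize f (t + τ / 2) (y + (τ / 2) • l₁) = l₂ at *
  generalize f (t + τ / 2) (x + (τ / 2) • k₂) = k₃ at *
  generalize f (t + τ / 2) (y + (τ / 2) • l₂) = l₃ at *
  generalize f (t + τ) (x + τ • k₃) = k₄ at *
  generalize f (t + τ) (y + τ • l₃) = l₄ at *
  calc _ = ‖(1 / 6 : ℝ) • ((k₁ - l₁) + (2 : ℝ) • (k₂ - l₂) + (2 : ℝ) • (k₃ - l₃)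
          + (k₄ - l₄))‖ := by congr 1; module
    _ ≤ (1 / 6) * (‖k₁ - l₁‖ + 2 * ‖k₂ - l₂‖ + 2 * ‖k₃ - l₃‖ + ‖k₄ - l₄‖) := by
        rw [norm_smul, Real.norm_of_nonneg (by norm_num)]
        gcongr
        refine norm_add₄_le.trans_eq ?_
        simp [norm_smul]
    _ ≤ _ := by linarith

/-- Two orbits of `x ↦ x + τ • Φ x`, with `Φ` being `M`-Lipschitz: bound on the difference of
their displacements from the initial values. -/
lemma norm_orbit_sub_le {E : Type*} [NormedAddCommGroup E] [NormedSpace ℝ E] {Φ : E → E}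
    {M τ : ℝ} (hM : 0 ≤ M) (hτ : 0 ≤ τ) (hΦ : ∀ x y, ‖Φ x - Φ y‖ ≤ M * ‖x - y‖)
    {a b : ℕ → E} (ha : ∀ j, a (j + 1) = a j + τ • Φ (a j))
    (hb : ∀ j, b (j + 1) = b j + τ • Φ (b j)) (j : ℕ) :
    ‖(a j - a 0) - (b j - b 0)‖ ≤ ((1 + τ * M) ^ j - 1) * ‖a 0 - b 0‖ := by
  induction j with
  | zero => simp
  | succ j ih =>
    have hab : ‖a j - b j‖ ≤ (1 + τ * M) ^ j * ‖a 0 - b 0‖ := by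
      calc ‖a j - b j‖ = ‖((a j - a 0) - (b j - b 0)) + (a 0 - b 0)‖ := by congr 1; abel
        _ ≤ _ := norm_add_le _ _
        _ ≤ _ := by linarith
    calc ‖(a (j + 1) - a 0) - (b (j + 1) - b 0)‖
        = ‖((a j - a 0) - (b j - b 0)) + τ • (Φ (a j) - Φ (b j))‖ := by
          rw [ha, hb]; congr 1; module
      _ ≤ ‖(a j - a 0) - (b j - b 0)‖ + τ * ‖Φ (a j) - Φ (b j)‖ := by
          refine (norm_add_le _ _).trans_eq ?_
          rw [norm_smul, Real.norm_of_nonneg hτ]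
      _ ≤ ((1 + τ * M) ^ j - 1) * ‖a 0 - b 0‖
          + τ * (M * ((1 + τ * M) ^ j * ‖a 0 - b 0‖)) := by
          gcongr
          exact (hΦ _ _).trans (by gcongr)
      _ = _ := by ring

/-- Lipschitz estimate for the difference between the `m`-step Runge–Kutta fine integrator
and the Euler coarse integrator: `‖(F(u)−C(u)) − (F(v)−C(v))‖ ≤ ((e^{hM}−1) + hL)‖u−v‖
= h(c₆ + L)‖u−v‖` with `c₆ = (e^{hM}−1)/h`. -/
theorem rk4_euler_difference_lipschitz
    {E : Type*} [NormedAddCommGroup E] [NormedSpace ℝ E]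
    (L : ℝ) (hL : 0 < L)
    (f : E → E)
    (hf : ∀ u v : E, ‖f u - f v‖ ≤ L * ‖u - v‖)
    (m : ℕ) (hm : 1 ≤ m) (h : ℝ) (hh : 0 < h)
    (τ : ℝ) (hτ : τ = h / m) (t : ℝ)
    (M : ℝ)
    (hM : M = L * (1 + (1 / 2) * τ * L + (1 / 6) * τ ^ 2 * L ^ 2 + (1 / 24) * τ ^ 3 * L ^ 3))
    (uh : ℕ → E → E)
    (huh0 : ∀ u : E, uh 0 u = u)
    (huhs : ∀ j : ℕ, ∀ u : E,
      uh (j + 1) u = uh j u + τ • rkF4 (fun _ x => f x) τ t (uh j u))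
    (C F : E → E)
    (hC : ∀ u : E, C u = u + h • f u)
    (hF : ∀ u : E, F u = uh m u) :
    ∀ u v : E,
      ‖(F u - C u) - (F v - C v)‖ ≤ ((Real.exp (h * M) - 1) + h * L) * ‖u - v‖ ∧
      ((Real.exp (h * M) - 1) + h * L) * ‖u - v‖ ≤
        h * ((Real.exp (h * M) - 1) / h + L) * ‖u - v‖ := by
  intro u v
  have hm0 : (0 : ℝ) < m := by exact_mod_cast hm
  have hτ0 : 0 < τ := hτ ▸ div_pos hh hm0
  have hM0 : 0 ≤ M := by rw [hM]; positivity
  refine ⟨?_, le_of_eq (by field_simp)⟩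
  have hΦ : ∀ x y : E, ‖rkF4 (fun _ x => f x) τ t x - rkF4 (fun _ x => f x) τ t y‖
      ≤ M * ‖x - y‖ := fun x y =>
    hM ▸ norm_rkF4_sub_le hL.le hτ0.le (fun _ => hf) t x y
  have hfine := norm_orbit_sub_le hM0 hτ0.le hΦ (a := fun j => uh j u) (b := fun j => uh j v)
    (fun j => huhs j u) (fun j => huhs j v) m
  simp only [huh0] at hfine
  have hexp : (1 + τ * M) ^ m ≤ Real.exp (h * M) := by
    calc (1 + τ * M) ^ m ≤ Real.exp (τ * M) ^ m := by
          gcongr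
          linarith [Real.add_one_le_exp (τ * M)]
      _ = Real.exp (h * M) := by
          rw [← Real.exp_nat_mul, hτ]
          congr 1
          field_simp
  calc ‖(F u - C u) - (F v - C v)‖
      = ‖((uh m u - u) - (uh m v - v)) - h • (f u - f v)‖ := by
        rw [hF, hF, hC, hC]; congr 1; module
    _ ≤ ‖(uh m u - u) - (uh m v - v)‖ + h * ‖f u - f v‖ := by
        refine (norm_sub_le _ _).trans_eq ?_
        rw [norm_smul, Real.norm_of_nonneg hh.le]
    _ ≤ (Real.exp (h * M) - 1) * ‖u - v‖ + h * (L * ‖u - v‖) := by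
        gcongr
        · exact hfine.trans (by gcongr)
        · exact hf u v
    _ = _ := by ring
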